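/- For every integer n ≥ 2, in ℤ[q] one has ∑_{σ ∈ D_n} q^{exc^Clr(σ)} (−1)^{cyc(σ)} = (q^2 − 1) · ∑_{σ ∈ D_{n−1}} q^{exc^Clr(σ)} (−1)^{cyc(σ)}, where D_n is the group of even signed permutations. -/

import Mathlib

open Finset Polynomial

/-- Number of excedances of a permutation: #{i : τ(i) > i}. -/
def exc {n : ℕ} (τ : Equiv.Perm (Fin n)) : ℕ :=
  (Finset.univ.filter fun i => i < τ i).card

/-- Number of cycles of a permutation, counting fixed points as cycles. -/
def cyc {n : ℕ} (τ : Equiv.Perm (Fin n)) : ℕ :=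
  Multiset.card τ.cycleType + (Finset.univ.filter fun i => τ i = i).card

/-- Color sum of a colored permutation. -/
def csum {r n : ℕ} (z : Fin n → Fin r) : ℕ := ∑ i, (z i : ℕ)

/-- #{i : z_i = 0 and τ(i) > i}. -/
def excA {r n : ℕ} (z : Fin n → Fin r) (τ : Equiv.Perm (Fin n)) : ℕ :=
  (Finset.univ.filter fun i => (z i : ℕ) = 0 ∧ i < τ i).card

/-- Excedance number with respect to the absolute order. -/
def excAbs {r n : ℕ} (z : Fin n → Fin r) (τ : Equiv.Perm (Fin n)) : ℕ :=
  exc τ + csum z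

/-- Excedance number with respect to the color order. -/
def excClr {r n : ℕ} (z : Fin n → Fin r) (τ : Equiv.Perm (Fin n)) : ℕ :=
  r * excA z τ + csum z

/-- The parity of the number of cycles is determined by the signature. -/
lemma neg_one_pow_cyc {n : ℕ} (τ : Equiv.Perm (Fin n)) :
    (-1 : ℤ[X]) ^ cyc τ = (-1) ^ n * ((Equiv.Perm.sign τ : ℤ) : ℤ[X]) := by
  have hfix : #τ.support + #{i | τ i = i} = n := by
    have h := Finset.card_filter_add_card_filter_not (s := univ) (fun i => τ i ≠ i)
    simpa [Equiv.Perm.support] using h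
  have hsq : (-1 : ℤ[X]) ^ #τ.support * (-1) ^ #τ.support = 1 := by
    rw [← mul_pow]; simp
  rw [Equiv.Perm.sign_of_cycleType, Equiv.Perm.sum_cycleType]
  have hn : (-1 : ℤ[X]) ^ n = (-1) ^ #τ.support * (-1) ^ #{i | τ i = i} := by
    rw [← pow_add, hfix]
  push_cast
  rw [hn, cyc, pow_add, pow_add]
  linear_combination (-(-1 : ℤ[X]) ^ τ.cycleType.card * (-1) ^ #{i | τ i = i}) * hsq

/-- Summing over all colorings of a fixed permutation factors over the positions. -/
lemma sum_colorings {R : Type*} [CommRing R] {n : ℕ} (x y : R) (τ : Equiv.Perm (Fin n)) :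
    ∑ z : Fin n → Fin 2, x ^ excA z τ * y ^ csum z =
      ∏ i, if i < τ i then x + y else 1 + y := by
  have hfactor (i : Fin n) : (if i < τ i then x + y else 1 + y) =
      ∑ c : Fin 2, (if (c : ℕ) = 0 ∧ i < τ i then x else 1) * y ^ (c : ℕ) := by
    split_ifs with h <;> simp [h]
  simp_rw [hfactor, Fintype.prod_sum]
  refine Finset.sum_congr rfl fun z _ => ?_
  rw [Finset.prod_mul_distrib, Finset.prod_pow_eq_pow_sum, Finset.prod_ite]
  simp [excA, csum]

/-- The determinant of the matrix with `b` below the diagonal and `a` elsewhere. -/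
lemma det_const_above_below {R : Type*} [CommRing R] (a b : R) (m : ℕ) :
    (Matrix.of fun i j : Fin (m + 1) => if j < i then b else a).det = a * (a - b) ^ m := by
  let B : Matrix (Fin (m + 1)) (Fin (m + 1)) R := Matrix.of fun i j =>
    Fin.cases (if 0 < i then b else a) (fun k => if i = k.succ then a - b else 0) j
  have hdet := Matrix.det_eq_of_forall_col_eq_smul_add_pred
    (A := Matrix.of fun i j : Fin (m + 1) => if j < i then b else a) (B := B) (fun _ => 1)
    (fun i => by simp [B])
    (fun i j => by
      simp only [Matrix.of_apply, Fin.cases_succ, B, Fin.ext_iff, Fin.lt_def, Fin.val_succ,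
        Fin.val_castSucc]
      split_ifs <;> first | omega | ring)
  have htri : B.BlockTriangular OrderDual.toDual := by
    intro i j hij
    replace hij : i < j := hij
    cases j using Fin.cases with
    | zero => simp at hij
    | succ k => simp [B, hij.ne]
  rw [hdet, Matrix.det_of_isLowerTriangular B htri, Fin.prod_univ_succ]
  simp [B]

/-- The signed two-parameter color excedance polynomial of the full colored group. -/
lemma sum_signed_colorings (m : ℕ) (x y : ℤ[X]) :
    ∑ σ : (Fin (m + 1) → Fin 2) × Equiv.Perm (Fin (m + 1)),
        x ^ excA σ.1 σ.2 * y ^ csum σ.1 * (-1) ^ cyc σ.2 =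
      (-1) ^ (m + 1) * ((1 + y) * (1 - x) ^ m) := by
  have hdet := det_const_above_below (1 + y) (x + y) m
  rw [show 1 + y - (x + y) = 1 - x by ring, Matrix.det_apply'] at hdet
  rw [← hdet, Fintype.sum_prod_type_right, Finset.mul_sum]
  refine Finset.sum_congr rfl fun τ _ => ?_
  dsimp only
  rw [← Finset.sum_mul, sum_colorings, neg_one_pow_cyc]
  simp only [Matrix.of_apply]
  ring

/-- The signed color excedance polynomial of the even signed permutations. -/
lemma sum_even_signed (m : ℕ) :
    ∑ σ ∈ Finset.univ.filter
        (fun σ : (Fin (m + 1) → Fin 2) × Equiv.Perm (Fin (m + 1)) => Even (csum σ.1)),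
      (X : ℤ[X]) ^ excClr σ.1 σ.2 * (-1) ^ cyc σ.2 = -(X ^ 2 - 1) ^ m := by
  apply mul_left_cancel₀ (two_ne_zero (α := ℤ[X]))
  have hsplit : 2 * ∑ σ ∈ Finset.univ.filter
        (fun σ : (Fin (m + 1) → Fin 2) × Equiv.Perm (Fin (m + 1)) => Even (csum σ.1)),
      (X : ℤ[X]) ^ excClr σ.1 σ.2 * (-1) ^ cyc σ.2 =
      ∑ σ : (Fin (m + 1) → Fin 2) × Equiv.Perm (Fin (m + 1)),
        (X ^ 2 : ℤ[X]) ^ excA σ.1 σ.2 * X ^ csum σ.1 * (-1) ^ cyc σ.2 +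
      ∑ σ : (Fin (m + 1) → Fin 2) × Equiv.Perm (Fin (m + 1)),
        (X ^ 2 : ℤ[X]) ^ excA σ.1 σ.2 * (-X) ^ csum σ.1 * (-1) ^ cyc σ.2 := by
    rw [Finset.sum_filter, Finset.mul_sum, ← Finset.sum_add_distrib]
    refine Finset.sum_congr rfl fun σ _ => ?_
    rw [excClr, pow_add, pow_mul]
    split_ifs with h
    · rw [h.neg_pow]; ring
    · rw [(Nat.not_even_iff_odd.mp h).neg_pow]; ring
  rw [hsplit, sum_signed_colorings, sum_signed_colorings,
    show (X ^ 2 - 1 : ℤ[X]) = -1 * (1 - X ^ 2) by ring, mul_pow]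
  ring

theorem stmt8 (n : ℕ) (hn : 2 ≤ n) :
    ∑ σ ∈ Finset.univ.filter
        (fun σ : (Fin n → Fin 2) × Equiv.Perm (Fin n) => Even (csum σ.1)),
      (X : Polynomial ℤ) ^ excClr σ.1 σ.2 * (-1) ^ cyc σ.2 =
    ((X : Polynomial ℤ) ^ 2 - 1) *
      ∑ σ ∈ Finset.univ.filter
          (fun σ : (Fin (n - 1) → Fin 2) × Equiv.Perm (Fin (n - 1)) => Even (csum σ.1)),
        (X : Polynomial ℤ) ^ excClr σ.1 σ.2 * (-1) ^ cyc σ.2 := by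
  obtain ⟨m, rfl⟩ := Nat.exists_eq_add_of_le' hn
  rw [show m + 2 - 1 = m + 1 from rfl, sum_even_signed m, sum_even_signed (m + 1), pow_succ]
  ring
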